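/- Corollary of the telescoping lemma: Let M = (S, A, T, r, μ₀, γ) and M̃ = (S, A, T̃, r, μ₀, γ) be two finite discounted MDPs differing only in their dynamics, and let π be a stationary stochastic policy. Then η_M(π) = Ē_{(s,a)∼ρ_{T̃}^π}[r(s, a) − γ · G_M̃^π(s, a)], and consequently η_M(π) ≥ Ē_{(s,a)∼ρ_{T̃}^π}[r(s, a) − γ · |G_M̃^π(s, a)|]. -/

import Mathlib

open scoped BigOperators

/-- Expectation of a real-valued function under a `PMF` on a finite type. -/
noncomputable def pmfExp {X : Type*} [Fintype X] (d : PMF X) (f : X → ℝ) : ℝ :=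
  ∑ x, (d x).toReal * f x

/-- Initial state–action distribution: `s ∼ μ`, `a ∼ π s`. -/
noncomputable def initSA {S A : Type*} (π : S → PMF A) (μ : PMF S) : PMF (S × A) :=
  μ.bind fun s => (π s).map fun a => (s, a)

/-- One step of the state–action Markov chain induced by dynamics `T` and policy `π`. -/
noncomputable def stepSA {S A : Type*} (T : S → A → PMF S) (π : S → PMF A)
    (d : PMF (S × A)) : PMF (S × A) :=
  d.bind fun sa => (T sa.1 sa.2).bind fun s' => (π s').map fun a' => (s', a')

/-- Distribution of the time-`t` state–action pair of the chain started from `μ`. -/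
noncomputable def saDist {S A : Type*} (T : S → A → PMF S) (π : S → PMF A)
    (μ : PMF S) : ℕ → PMF (S × A)
  | 0 => initSA π μ
  | (t + 1) => stepSA T π (saDist T π μ t)

/-- Unnormalized discounted occupancy expectation
`Ē_{(s,a)∼ρ_T^π}[f] = Σ_t γ^t E[f(s_t,a_t)]`, chain started from `μ`. -/
noncomputable def occExp {S A : Type*} [Fintype S] [Fintype A]
    (T : S → A → PMF S) (π : S → PMF A) (μ : PMF S) (γ : ℝ) (f : S × A → ℝ) : ℝ :=
  ∑' t : ℕ, γ ^ t * pmfExp (saDist T π μ t) f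

/-- Value function `V_M^π(s)` of the MDP with dynamics `T`, reward `r`, discount `γ`. -/
noncomputable def valueFun {S A : Type*} [Fintype S] [Fintype A]
    (T : S → A → PMF S) (π : S → PMF A) (r : S × A → ℝ) (γ : ℝ) (s : S) : ℝ :=
  occExp T π (PMF.pure s) γ r

/-- Expected return `η_M(π) = E_{s∼μ₀}[V_M^π(s)]`. -/
noncomputable def expReturn {S A : Type*} [Fintype S] [Fintype A]
    (T : S → A → PMF S) (π : S → PMF A) (r : S × A → ℝ) (γ : ℝ) (μ : PMF S) : ℝ :=
  ∑ s, (μ s).toReal * valueFun T π r γ s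

/-- Model-error gap `G_{M̃}^π(s,a) = E_{s'∼T̃(s,a)}[V_M^π(s')] − E_{s'∼T(s,a)}[V_M^π(s')]`,
where `T` is the true dynamics and `T'` the model dynamics. -/
noncomputable def Ggap {S A : Type*} [Fintype S] [Fintype A]
    (T T' : S → A → PMF S) (π : S → PMF A) (r : S × A → ℝ) (γ : ℝ) (sa : S × A) : ℝ :=
  (∑ s', ((T' sa.1 sa.2) s').toReal * valueFun T π r γ s') -
    (∑ s', ((T sa.1 sa.2) s').toReal * valueFun T π r γ s')

section Expectation

variable {X Y : Type*} [Fintype X] [Fintype Y]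

lemma pmfExp_bind (d : PMF X) (k : X → PMF Y) (f : Y → ℝ) :
    pmfExp (d.bind k) f = pmfExp d fun x => pmfExp (k x) f := by
  have h (y : Y) : (d.bind k y).toReal = ∑ x, (d x).toReal * (k x y).toReal := by
    rw [PMF.bind_apply, tsum_fintype, ENNReal.toReal_sum
      fun x _ => ENNReal.mul_ne_top (d.apply_ne_top x) ((k x).apply_ne_top y)]
    simp
  simp only [pmfExp, h, Finset.sum_mul, Finset.mul_sum]
  rw [Finset.sum_comm]
  simp only [mul_assoc]

lemma pmfExp_pure (x : X) (f : X → ℝ) : pmfExp (PMF.pure x) f = f x := by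
  classical
  simp [pmfExp, PMF.pure_apply, apply_ite ENNReal.toReal]

lemma pmfExp_map (d : PMF X) (g : X → Y) (f : Y → ℝ) :
    pmfExp (d.map g) f = pmfExp d fun x => f (g x) := by
  simp [PMF.map, pmfExp_bind, pmfExp_pure]

lemma pmfExp_add (d : PMF X) (f g : X → ℝ) :
    pmfExp d (fun x => f x + g x) = pmfExp d f + pmfExp d g := by
  simp [pmfExp, mul_add, Finset.sum_add_distrib]

lemma pmfExp_sub (d : PMF X) (f g : X → ℝ) :
    pmfExp d (fun x => f x - g x) = pmfExp d f - pmfExp d g := by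
  simp [pmfExp, mul_sub, Finset.sum_sub_distrib]

lemma pmfExp_const_mul (d : PMF X) (c : ℝ) (f : X → ℝ) :
    pmfExp d (fun x => c * f x) = c * pmfExp d f := by
  simp [pmfExp, Finset.mul_sum, mul_left_comm]

lemma pmfExp_mono (d : PMF X) {f g : X → ℝ} (h : ∀ x, f x ≤ g x) :
    pmfExp d f ≤ pmfExp d g :=
  Finset.sum_le_sum fun x _ => mul_le_mul_of_nonneg_left (h x) ENNReal.toReal_nonneg

lemma abs_pmfExp_le (d : PMF X) (f : X → ℝ) : |pmfExp d f| ≤ ∑ x, |f x| := by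
  refine (Finset.abs_sum_le_sum_abs _ _).trans (Finset.sum_le_sum fun x _ => ?_)
  rw [abs_mul, abs_of_nonneg ENNReal.toReal_nonneg]
  refine mul_le_of_le_one_left (abs_nonneg _) ?_
  exact ENNReal.toReal_le_of_le_ofReal zero_le_one (by simpa using d.coe_le_one x)

lemma summable_pow_mul_pmfExp {γ : ℝ} (hγ0 : 0 ≤ γ) (hγ1 : γ < 1) (d : ℕ → PMF X) (f : X → ℝ) :
    Summable fun t => γ ^ t * pmfExp (d t) f := by
  refine Summable.of_norm_bounded
    ((summable_geometric_of_lt_one hγ0 hγ1).mul_right (∑ x, |f x|)) fun t => ?_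
  rw [Real.norm_eq_abs, abs_mul, abs_of_nonneg (pow_nonneg hγ0 t)]
  exact mul_le_mul_of_nonneg_left (abs_pmfExp_le _ _) (pow_nonneg hγ0 t)

end Expectation

section Chain

variable {S A : Type*} (T : S → A → PMF S) (π : S → PMF A) (μ : PMF S)

lemma saDist_eq_bind_pure (t : ℕ) :
    saDist T π μ t = μ.bind fun s => saDist T π (PMF.pure s) t := by
  induction t with
  | zero => simp [saDist, initSA]
  | succ t ih =>
    rw [saDist, ih]
    simp [saDist, stepSA, PMF.bind_bind]

lemma saDist_succ_eq_saDist_bind (t : ℕ) :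
    saDist T π μ (t + 1) = saDist T π ((initSA π μ).bind fun sa => T sa.1 sa.2) t := by
  induction t with
  | zero => simp [saDist, stepSA, initSA, PMF.bind_bind, Function.comp_def]
  | succ t ih => rw [saDist, ih, saDist]

variable [Fintype S] [Fintype A]

lemma pmfExp_initSA (f : S × A → ℝ) :
    pmfExp (initSA π μ) f = pmfExp μ fun s => pmfExp (π s) fun a => f (s, a) := by
  simp [initSA, pmfExp_bind, pmfExp_map]

lemma pmfExp_stepSA (d : PMF (S × A)) (f : S × A → ℝ) :
    pmfExp (stepSA T π d) f =
      pmfExp d fun sa => pmfExp (T sa.1 sa.2) fun s => pmfExp (π s) fun a => f (s, a) := by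
  simp [stepSA, pmfExp_bind, pmfExp_map]

variable (r : S × A → ℝ) {γ : ℝ}

lemma occExp_eq_pmfExp_valueFun (hγ0 : 0 ≤ γ) (hγ1 : γ < 1) :
    occExp T π μ γ r = pmfExp μ (valueFun T π r γ) := by
  have h (t : ℕ) : γ ^ t * pmfExp (saDist T π μ t) r =
      ∑ s, (μ s).toReal * (γ ^ t * pmfExp (saDist T π (PMF.pure s) t) r) := by
    rw [saDist_eq_bind_pure, pmfExp_bind, ← pmfExp_const_mul, pmfExp]
  simp only [occExp, h]
  rw [Summable.tsum_finsetSum fun s _ =>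
    (summable_pow_mul_pmfExp hγ0 hγ1 (saDist T π (PMF.pure s)) r).mul_left _]
  simp only [tsum_mul_left, pmfExp, valueFun, occExp]

/-- The Bellman equation for `valueFun`. -/
lemma valueFun_eq_bellman (hγ0 : 0 ≤ γ) (hγ1 : γ < 1) (s : S) :
    valueFun T π r γ s =
      pmfExp (π s) fun a => r (s, a) + γ * pmfExp (T s a) (valueFun T π r γ) := by
  have hnext := occExp_eq_pmfExp_valueFun T π
    ((initSA π (PMF.pure s)).bind fun sa => T sa.1 sa.2) r hγ0 hγ1
  rw [pmfExp_bind, pmfExp_initSA, pmfExp_pure] at hnext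
  rw [pmfExp_add, pmfExp_const_mul, ← hnext, valueFun, occExp,
    (summable_pow_mul_pmfExp hγ0 hγ1 (saDist T π (PMF.pure s)) r).tsum_eq_zero_add]
  simp only [saDist_succ_eq_saDist_bind, pow_succ', mul_assoc, tsum_mul_left]
  simp [saDist, pmfExp_initSA, pmfExp_pure, occExp]

lemma occExp_mono (hγ0 : 0 ≤ γ) (hγ1 : γ < 1) {f g : S × A → ℝ} (h : ∀ sa, f sa ≤ g sa) :
    occExp T π μ γ f ≤ occExp T π μ γ g :=
  Summable.tsum_le_tsum
    (fun t => mul_le_mul_of_nonneg_left (pmfExp_mono _ h) (pow_nonneg hγ0 t))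
    (summable_pow_mul_pmfExp hγ0 hγ1 _ f) (summable_pow_mul_pmfExp hγ0 hγ1 _ g)

/-- Discounted Bellman residuals of `Q` telescope to the initial expectation of `Q`. -/
lemma occExp_sub_next (hγ0 : 0 ≤ γ) (hγ1 : γ < 1) (Q : S × A → ℝ) :
    occExp T π μ γ (fun sa => Q sa - γ * pmfExp (T sa.1 sa.2) fun s =>
      pmfExp (π s) fun a => Q (s, a)) = pmfExp (initSA π μ) Q := by
  have hs := summable_pow_mul_pmfExp hγ0 hγ1 (saDist T π μ) Q
  have h (t : ℕ) : γ ^ t * pmfExp (saDist T π μ t) (fun sa => Q sa - γ *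
      pmfExp (T sa.1 sa.2) fun s => pmfExp (π s) fun a => Q (s, a)) =
      γ ^ t * pmfExp (saDist T π μ t) Q -
        γ ^ (t + 1) * pmfExp (saDist T π μ (t + 1)) Q := by
    rw [pmfExp_sub, pmfExp_const_mul, saDist, pmfExp_stepSA]
    ring
  rw [occExp, tsum_congr h, hs.tsum_sub ((summable_nat_add_iff 1).2 hs), hs.tsum_eq_zero_add]
  simp [saDist]

end Chain

/-- **Corollary of the telescoping lemma.**
`η_M(π) = Ē_{(s,a)∼ρ_{T̃}^π}[r(s,a) − γ·G_{M̃}^π(s,a)]`, hence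
`η_M(π) ≥ Ē_{(s,a)∼ρ_{T̃}^π}[r(s,a) − γ·|G_{M̃}^π(s,a)|]`. -/
theorem telescoping_corollary
    {S A : Type*} [Fintype S] [Fintype A] [Nonempty S] [Nonempty A]
    (T T' : S → A → PMF S) (r : S × A → ℝ) (μ₀ : PMF S) (γ : ℝ)
    (hγ0 : 0 ≤ γ) (hγ1 : γ < 1) (π : S → PMF A) :
    expReturn T π r γ μ₀ =
      occExp T' π μ₀ γ (fun sa => r sa - γ * Ggap T T' π r γ sa) ∧
    expReturn T π r γ μ₀ ≥
      occExp T' π μ₀ γ (fun sa => r sa - γ * |Ggap T T' π r γ sa|) := by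
  have heq : expReturn T π r γ μ₀ =
      occExp T' π μ₀ γ (fun sa => r sa - γ * Ggap T T' π r γ sa) := by
    have h := occExp_sub_next T' π μ₀ hγ0 hγ1
      fun sa => r sa + γ * pmfExp (T sa.1 sa.2) (valueFun T π r γ)
    simp only [pmfExp_initSA, ← valueFun_eq_bellman T π r hγ0 hγ1] at h
    change pmfExp μ₀ (valueFun T π r γ) = _
    rw [← h]
    congr 1
    ext sa
    simp only [Ggap, pmfExp]
    ring
  refine ⟨heq, heq ▸ occExp_mono T' π μ₀ hγ0 hγ1 fun sa => ?_⟩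
  exact sub_le_sub_left (mul_le_mul_of_nonneg_left (le_abs_self _) hγ0) _
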